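/- Let X be a totally ordered discrete abelian group with positive cone X₊ and let X^i denote the set of χ ∈ X₊ for which X₊ \ χX₊ is finite, together with quotients of such elements. If χ₁, χ₂ ∈ X₊ both satisfy that X₊ \ χ_j X₊ is finite, then X₊ \ (χ₁χ₂)X₊ is finite and #(X₊ \ χ₁χ₂X₊) = #(X₊ \ χ₁X₊) + #(X₊ \ χ₂X₊). -/

import Mathlib

/-- Additivity of the rotation index: if `X₊ \ χⱼX₊` is finite
for `j = 1, 2`, then `X₊ \ (χ₁χ₂)X₊` is finite with cardinality the sum of the
cardinalities. -/
theorem rotation_index_additive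
    {X : Type*} [CommGroup X]
    (P : Set X) (hone : (1 : X) ∈ P)
    (hmul : ∀ a ∈ P, ∀ b ∈ P, a * b ∈ P)
    (hcap : P ∩ P⁻¹ = {1}) (hcup : P ∪ P⁻¹ = Set.univ)
    (χ₁ χ₂ : X) (hχ₁ : χ₁ ∈ P) (hχ₂ : χ₂ ∈ P)
    (h₁ : (P \ (fun ξ => χ₁ * ξ) '' P).Finite)
    (h₂ : (P \ (fun ξ => χ₂ * ξ) '' P).Finite) :
    (P \ (fun ξ => (χ₁ * χ₂) * ξ) '' P).Finite ∧
      (P \ (fun ξ => (χ₁ * χ₂) * ξ) '' P).ncard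
        = (P \ (fun ξ => χ₁ * ξ) '' P).ncard + (P \ (fun ξ => χ₂ * ξ) '' P).ncard := by
  have key : P \ (fun ξ => (χ₁ * χ₂) * ξ) '' P
      = (P \ (fun ξ => χ₁ * ξ) '' P) ∪ (fun ξ => χ₁ * ξ) '' (P \ (fun ξ => χ₂ * ξ) '' P) := by
    ext x
    constructor
    · rintro ⟨hx, hn⟩
      by_cases h : x ∈ (fun ξ => χ₁ * ξ) '' P
      · right
        obtain ⟨y, hy, rfl⟩ := h
        refine ⟨y, ⟨hy, ?_⟩, rfl⟩
        rintro ⟨z, hz, rfl⟩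
        exact hn ⟨z, hz, mul_assoc _ _ _⟩
      · exact Or.inl ⟨hx, h⟩
    · rintro (⟨hx, hn⟩ | ⟨y, ⟨hy, hn⟩, rfl⟩)
      · refine ⟨hx, ?_⟩
        rintro ⟨z, hz, rfl⟩
        exact hn ⟨χ₂ * z, hmul _ hχ₂ _ hz, (mul_assoc _ _ _).symm⟩
      · refine ⟨hmul _ hχ₁ _ hy, ?_⟩
        rintro ⟨z, hz, hzy⟩
        refine hn ⟨z, hz, ?_⟩
        have hzy' : χ₁ * χ₂ * z = χ₁ * y := hzy
        rw [mul_assoc] at hzy'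
        exact mul_left_cancel hzy'
  have hdisj : Disjoint (P \ (fun ξ => χ₁ * ξ) '' P)
      ((fun ξ => χ₁ * ξ) '' (P \ (fun ξ => χ₂ * ξ) '' P)) := by
    rw [Set.disjoint_left]
    rintro x ⟨_, hn⟩ ⟨y, hy, rfl⟩
    exact hn ⟨y, hy.1, rfl⟩
  rw [key]
  refine ⟨h₁.union (h₂.image _), ?_⟩
  rw [Set.ncard_union_eq hdisj h₁ (h₂.image _),
    Set.ncard_image_of_injective _ (mul_right_injective χ₁)]
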